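/- Suppose ℓ1, ℓ2, ξ1, ξ2, η1, η2, κ > 0 and M1 ≠ 0. Then there exists a real number L such that [F0,F2](O) = κ·L·X4(O) and [F1,F2](O) = M1·L·X3(O), where O = (0,0,0,0); moreover L ≠ 0 if and only if (3 + 4ℓ2/ℓ1 + η2ℓ2²/(η1ℓ1²)) M1 − (3 + 4ℓ1/ℓ2 + η1ℓ1²/(η2ℓ2²)) M2 ≠ 0. -/

import Mathlib

open Real Matrix Set

/-- The 4×4 matrix E(α) of the two-link magneto-elastic swimmer,
with blocks E11, E12, E21, E22 as in the paper. -/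
noncomputable def Emat (l1 l2 x1 x2 e1 e2 a : ℝ) : Matrix (Fin 4) (Fin 4) ℝ :=
  !![ -(x1*l1 + x2*l2) * Real.cos a, -(x1*l1 + e2*l2) * Real.sin a,
        (1/2)*x1*l1*l2*Real.sin a, 0;
      (e1*l1 + x2*l2) * Real.sin a, -(e1*l1 + e2*l2) * Real.cos a,
        (1/2)*e1*l1*(l1 + l2*Real.cos a), (1/2)*e1*l1^2;
      (1/2)*(e1*l1^2*(-Real.sin a)), (1/2)*(e1*l1^2*Real.cos a - e2*l2^2),
        -(e1*l1^2*((1/4)*l2*Real.cos a + (1/3)*l1) + e2*l2^2*((1/12)*l2)),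
        -(e1*l1^2*((1/3)*l1));
      0, (1/2)*(-(e2*l2^2)), -(e2*l2^2*((1/12)*l2)), 0]

/-- R̃(θ) = diag(R_θ, I₂). -/
noncomputable def Rtil (th : ℝ) : Matrix (Fin 4) (Fin 4) ℝ :=
  !![Real.cos th, -Real.sin th, 0, 0;
     Real.sin th,  Real.cos th, 0, 0;
     0, 0, 1, 0;
     0, 0, 0, 1]

/-- X3(z) = R̃(θ)·(third column of E(α)⁻¹), where z = (x,y,θ,α). -/
noncomputable def X3 (l1 l2 x1 x2 e1 e2 : ℝ) (z : Fin 4 → ℝ) : Fin 4 → ℝ :=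
  (Rtil (z 2)).mulVec fun i => (Emat l1 l2 x1 x2 e1 e2 (z 3))⁻¹ i 2

/-- X4(z) = R̃(θ)·(fourth column of E(α)⁻¹), where z = (x,y,θ,α). -/
noncomputable def X4 (l1 l2 x1 x2 e1 e2 : ℝ) (z : Fin 4 → ℝ) : Fin 4 → ℝ :=
  (Rtil (z 2)).mulVec fun i => (Emat l1 l2 x1 x2 e1 e2 (z 3))⁻¹ i 3

/-- F0(z) = κ α X4(z). -/
noncomputable def F0 (l1 l2 x1 x2 e1 e2 k : ℝ) (z : Fin 4 → ℝ) : Fin 4 → ℝ :=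
  (k * z 3) • X4 l1 l2 x1 x2 e1 e2 z

/-- F1(z) = M1 sin α · X3(z). -/
noncomputable def F1 (l1 l2 x1 x2 e1 e2 M1 : ℝ) (z : Fin 4 → ℝ) : Fin 4 → ℝ :=
  (M1 * Real.sin (z 3)) • X3 l1 l2 x1 x2 e1 e2 z

/-- F2(z) = −(M1 cos α + M2) X3(z) − M2 X4(z). -/
noncomputable def F2 (l1 l2 x1 x2 e1 e2 M1 M2 : ℝ) (z : Fin 4 → ℝ) : Fin 4 → ℝ :=
  (-(M1 * Real.cos (z 3) + M2)) • X3 l1 l2 x1 x2 e1 e2 z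
    - M2 • X4 l1 l2 x1 x2 e1 e2 z

/-- Lie bracket of two vector fields on ℝ⁴: [X,Y](z) = DY(z)·X(z) − DX(z)·Y(z). -/
noncomputable def lieBr (X Y : (Fin 4 → ℝ) → (Fin 4 → ℝ)) (z : Fin 4 → ℝ) : Fin 4 → ℝ :=
  fderiv ℝ Y z (X z) - fderiv ℝ X z (Y z)

/-- The origin O = (0,0,0,0). -/
def Ovec : Fin 4 → ℝ := ![0, 0, 0, 0]

/-- Assumption A of the paper. -/
def AssumptionA (l1 l2 x1 x2 e1 e2 M1 M2 : ℝ) : Prop :=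
  ((e1 - x1, e2 - x2) ≠ (0, 0)) ∧ x1 ≤ e1 ∧ x2 ≤ e2 ∧ M1 ≠ 0 ∧ M2 ≠ 0 ∧
    (3 + 4*(l2/l1) + e2*l2^2/(e1*l1^2)) * M1
      - (3 + 4*(l1/l2) + e1*l1^2/(e2*l2^2)) * M2 ≠ 0

/-- A product of a function vanishing at `x` and a function merely continuous at `x` is
differentiable at `x`. -/
theorem hasFDerivAt_smul_of_eq_zero {V W : Type*} [NormedAddCommGroup V] [NormedSpace ℝ V]
    [NormedAddCommGroup W] [NormedSpace ℝ W] {f : V → ℝ} {g : V → W} {f' : V →L[ℝ] ℝ} {x : V}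
    (hf : HasFDerivAt f f' x) (hfx : f x = 0) (hg : ContinuousAt g x) :
    HasFDerivAt (fun z => f z • g z) (f'.smulRight (g x)) x := by
  have hconst : HasFDerivAt (fun z => f z • g x) (f'.smulRight (g x)) x := hf.smul_const (g x)
  have hO : f =O[nhds x] fun z => z - x := by simpa [hfx] using hf.isBigO_sub
  have ho : (fun z => g z - g x) =o[nhds x] fun _ => (1 : ℝ) :=
    (Asymptotics.isLittleO_one_iff ℝ).2 (by simpa using hg.sub_const (g x))
  have hrest : HasFDerivAt (fun z => f z • (g z - g x)) (0 : V →L[ℝ] W) x := by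
    rw [hasFDerivAt_iff_isLittleO]
    have h := (hO.norm_right.smul_isLittleO ho).norm_right
    simpa [hfx] using h
  refine (hconst.add hrest).congr_fderiv (add_zero _) |>.congr_of_eventuallyEq ?_
  filter_upwards with z
  simp [smul_sub]

/-- The bracket at a zero of the first field, when that field is `f • g` with `f` vanishing. -/
theorem lieBr_smul_of_eq_zero {f : (Fin 4 → ℝ) → ℝ} {g Y : (Fin 4 → ℝ) → Fin 4 → ℝ}
    {f' : (Fin 4 → ℝ) →L[ℝ] ℝ} {x : Fin 4 → ℝ}
    (hf : HasFDerivAt f f' x) (hfx : f x = 0) (hg : ContinuousAt g x) :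
    lieBr (fun z => f z • g z) Y x = -(f' (Y x)) • g x := by
  simp [lieBr, (hasFDerivAt_smul_of_eq_zero hf hfx hg).fderiv, hfx]

theorem det_Emat_zero (l1 l2 x1 x2 e1 e2 : ℝ) :
    (Emat l1 l2 x1 x2 e1 e2 0).det =
      -(x1 * l1 + x2 * l2) * (e1 * e2 * l1 ^ 3 * l2 ^ 3 * (e1 * l1 + e2 * l2) / 36) := by
  simp [Emat, det_succ_row_zero, Fin.sum_univ_succ, Fin.succAbove, -mul_eq_mul_left_iff]
  ring

theorem det_Emat_zero_ne_zero {l1 l2 x1 x2 e1 e2 : ℝ} (hl1 : 0 < l1) (hl2 : 0 < l2)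
    (hx1 : 0 < x1) (hx2 : 0 < x2) (he1 : 0 < e1) (he2 : 0 < e2) :
    (Emat l1 l2 x1 x2 e1 e2 0).det ≠ 0 := by
  rw [det_Emat_zero]
  have : 0 < x1 * l1 + x2 * l2 := by positivity
  exact mul_ne_zero (neg_ne_zero.2 this.ne') (by positivity)

theorem continuous_Emat (l1 l2 x1 x2 e1 e2 : ℝ) : Continuous (Emat l1 l2 x1 x2 e1 e2) := by
  refine continuous_matrix fun i j => ?_
  fin_cases i <;> fin_cases j <;> simp [Emat] <;> fun_prop

theorem continuous_Rtil : Continuous Rtil := by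
  refine continuous_matrix fun i j => ?_
  fin_cases i <;> fin_cases j <;> simp [Rtil] <;> fun_prop

theorem continuousAt_Rtil_mulVec_Emat_inv_col {l1 l2 x1 x2 e1 e2 : ℝ} {z : Fin 4 → ℝ}
    (hdet : (Emat l1 l2 x1 x2 e1 e2 (z 3)).det ≠ 0) (j : Fin 4) :
    ContinuousAt (fun z : Fin 4 → ℝ =>
      (Rtil (z 2)).mulVec fun i => (Emat l1 l2 x1 x2 e1 e2 (z 3))⁻¹ i j) z := by
  have hE : Continuous fun z : Fin 4 → ℝ => Emat l1 l2 x1 x2 e1 e2 (z 3) :=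
    (continuous_Emat l1 l2 x1 x2 e1 e2).comp (continuous_apply 3)
  have hR : Continuous fun z : Fin 4 → ℝ => Rtil (z 2) := continuous_Rtil.comp (continuous_apply 2)
  have hinv : ∀ i, ContinuousAt (fun z : Fin 4 → ℝ => (Emat l1 l2 x1 x2 e1 e2 (z 3))⁻¹ i j) z := by
    intro i
    simp only [inv_def, Ring.inverse_eq_inv', Matrix.smul_apply, smul_eq_mul]
    exact (hE.matrix_det.continuousAt.inv₀ hdet).mul
      (hE.matrix_adjugate.matrix_elem i j).continuousAt
  refine continuousAt_pi.2 fun i => ?_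
  simp only [mulVec, dotProduct]
  exact tendsto_finsetSum _ fun m _ => (hR.matrix_elem i m).continuousAt.mul (hinv m)

/-- The last row of `E(0)⁻¹`. -/
theorem Emat_zero_inv_last_row {l1 l2 x1 x2 e1 e2 : ℝ} (hl1 : 0 < l1) (hl2 : 0 < l2)
    (hx1 : 0 < x1) (hx2 : 0 < x2) (he1 : 0 < e1) (he2 : 0 < e2) :
    (Emat l1 l2 x1 x2 e1 e2 0)⁻¹ 3 =
      ![0, -6 * (l1 + l2) / (l1 * l2 * (e1 * l1 + e2 * l2)),
        -3 * (3 + 4 * (l2 / l1) + e2 * l2 ^ 2 / (e1 * l1 ^ 2)) / (l1 * l2 * (e1 * l1 + e2 * l2)),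
        3 * ((3 + 4 * (l2 / l1) + e2 * l2 ^ 2 / (e1 * l1 ^ 2))
          + (3 + 4 * (l1 / l2) + e1 * l1 ^ 2 / (e2 * l2 ^ 2)))
          / (l1 * l2 * (e1 * l1 + e2 * l2))] := by
  have hu : IsUnit (Emat l1 l2 x1 x2 e1 e2 0).det :=
    (det_Emat_zero_ne_zero hl1 hl2 hx1 hx2 he1 he2).isUnit
  have hs : e1 * l1 + e2 * l2 ≠ 0 := by positivity
  refine vecMul_injective_of_isUnit ((isUnit_iff_isUnit_det _).2 hu) ?_
  have hrow : (Emat l1 l2 x1 x2 e1 e2 0)⁻¹ 3 ᵥ* Emat l1 l2 x1 x2 e1 e2 0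
      = ![0, 0, 0, 1] := by
    rw [← mul_apply_eq_vecMul, nonsing_inv_mul _ hu]
    ext j
    fin_cases j <;> simp [one_apply]
  simp only [hrow]
  ext j
  fin_cases j <;> simp [Emat, vecMul, dotProduct, Fin.sum_univ_succ] <;> field_simp <;> ring

/-- the brackets f₀₂ and f₁₂ at the origin, and the constant L. -/
theorem stmt_12 (l1 l2 x1 x2 e1 e2 k M1 M2 : ℝ)
    (hl1 : 0 < l1) (hl2 : 0 < l2) (hx1 : 0 < x1) (hx2 : 0 < x2)
    (he1 : 0 < e1) (he2 : 0 < e2) (hk : 0 < k) (hM1 : M1 ≠ 0) :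
    ∃ L : ℝ,
      lieBr (F0 l1 l2 x1 x2 e1 e2 k) (F2 l1 l2 x1 x2 e1 e2 M1 M2) Ovec
        = (k * L) • X4 l1 l2 x1 x2 e1 e2 Ovec ∧
      lieBr (F1 l1 l2 x1 x2 e1 e2 M1) (F2 l1 l2 x1 x2 e1 e2 M1 M2) Ovec
        = (M1 * L) • X3 l1 l2 x1 x2 e1 e2 Ovec ∧
      (L ≠ 0 ↔
        (3 + 4*(l2/l1) + e2*l2^2/(e1*l1^2)) * M1
          - (3 + 4*(l1/l2) + e1*l1^2/(e2*l2^2)) * M2 ≠ 0) := by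
  have hdet : (Emat l1 l2 x1 x2 e1 e2 (Ovec 3)).det ≠ 0 :=
    det_Emat_zero_ne_zero hl1 hl2 hx1 hx2 he1 he2
  have h3 : ContinuousAt (X3 l1 l2 x1 x2 e1 e2) Ovec := continuousAt_Rtil_mulVec_Emat_inv_col hdet 2
  have h4 : ContinuousAt (X4 l1 l2 x1 x2 e1 e2) Ovec := continuousAt_Rtil_mulVec_Emat_inv_col hdet 3
  have hO : Ovec 3 = 0 := rfl
  have hproj : HasFDerivAt (fun z : Fin 4 → ℝ => z 3)
      (ContinuousLinearMap.proj (R := ℝ) (φ := fun _ : Fin 4 => ℝ) 3) Ovec :=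
    hasFDerivAt_apply 3 Ovec
  refine ⟨-F2 l1 l2 x1 x2 e1 e2 M1 M2 Ovec 3, ?_, ?_, ?_⟩
  · unfold F0
    simpa using lieBr_smul_of_eq_zero (Y := F2 l1 l2 x1 x2 e1 e2 M1 M2)
      (hproj.const_mul k) (by simp [hO]) h4
  · unfold F1
    simpa [hO] using lieBr_smul_of_eq_zero (Y := F2 l1 l2 x1 x2 e1 e2 M1 M2)
      (hproj.sin.const_mul M1) (by simp [hO]) h3
  · have hrow := Emat_zero_inv_last_row hl1 hl2 hx1 hx2 he1 he2
    have hX3 : X3 l1 l2 x1 x2 e1 e2 Ovec 3 = (Emat l1 l2 x1 x2 e1 e2 0)⁻¹ 3 2 := by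
      simp [X3, Rtil, mulVec, dotProduct, Fin.sum_univ_succ, hO]
    have hX4 : X4 l1 l2 x1 x2 e1 e2 Ovec 3 = (Emat l1 l2 x1 x2 e1 e2 0)⁻¹ 3 3 := by
      simp [X4, Rtil, mulVec, dotProduct, Fin.sum_univ_succ, hO]
    have hL : -F2 l1 l2 x1 x2 e1 e2 M1 M2 Ovec 3 =
        -3 / (l1 * l2 * (e1 * l1 + e2 * l2)) *
          ((3 + 4*(l2/l1) + e2*l2^2/(e1*l1^2)) * M1
            - (3 + 4*(l1/l2) + e1*l1^2/(e2*l2^2)) * M2) := by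
      simp only [F2, Pi.sub_apply, Pi.smul_apply, smul_eq_mul, hX3, hX4, hrow, hO, Real.cos_zero]
      simp
      ring
    have hs : -3 / (l1 * l2 * (e1 * l1 + e2 * l2)) ≠ 0 :=
      div_ne_zero (by norm_num) (by positivity)
    rw [hL, mul_ne_zero_iff, and_iff_right hs]
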